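/- There exist an irreducible homogeneous polynomial f of degree 6 in ℂ[x₀,x₁,x₂] and three points a, b, c ∈ ℂ³ ∖ {0}, pairwise linearly independent but all contained in a common 2-dimensional linear subspace of ℂ³ (so that they determine three distinct collinear points of ℂP²), such that: (i) f and all its first-order partial derivatives vanish at each of a, b, c; (ii) the Hessian matrix of f at each of a, b, c has rank 2 (so each is an ordinary double point); and (iii) for every v ∈ ℂ³ ∖ {0} with f(v) = 0 that is not a scalar multiple of a, b, or c, some first-order partial derivative of f is nonzero at v. That is, there exists an irreducible plane sextic curve having exactly three singular points, all of which are collinear ordinary double points. -/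

import Mathlib

open MvPolynomial

/-- The gradient of `f` at `a`: the vector of first partial derivatives
evaluated at `a`. -/
noncomputable def mvGradient (f : MvPolynomial (Fin 3) ℂ) (a : Fin 3 → ℂ) :
    Fin 3 → ℂ :=
  fun i => MvPolynomial.eval a (pderiv i f)

/-- The Hessian of `f` at `a`: the matrix of second partial derivatives
evaluated at `a`. -/
noncomputable def mvHessian (f : MvPolynomial (Fin 3) ℂ) (a : Fin 3 → ℂ) :
    Matrix (Fin 3) (Fin 3) ℂ :=
  Matrix.of fun i j => MvPolynomial.eval a (pderiv i (pderiv j f))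

/-- The sextic `(x³ - y³)² + x⁴z² + xz⁵` in the coordinates `(y, x, z)`. -/
noncomputable def nodalSextic : MvPolynomial (Fin 3) ℂ :=
  (X 1 ^ 3 - X 0 ^ 3) ^ 2 + X 1 ^ 4 * X 2 ^ 2 + X 1 * X 2 ^ 5

lemma nodalSextic_isHomogeneous : nodalSextic.IsHomogeneous 6 := by
  have h (i : Fin 3) := isHomogeneous_X ℂ i
  have h1 := (((h 1).pow 3).sub ((h 0).pow 3)).pow 2
  have h2 := ((h 1).pow 4).mul ((h 2).pow 2)
  have h3 := (h 1).mul ((h 2).pow 5)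
  exact (h1.add h2).add h3

lemma eval_nodalSextic (v : Fin 3 → ℂ) :
    eval v nodalSextic = (v 1 ^ 3 - v 0 ^ 3) ^ 2 + v 1 ^ 4 * v 2 ^ 2 + v 1 * v 2 ^ 5 := by
  simp [nodalSextic]

lemma pderiv_zero_nodalSextic :
    pderiv 0 nodalSextic = C (-6) * (X 0 ^ 2 * (X 1 ^ 3 - X 0 ^ 3)) := by
  simp [nodalSextic, pderiv_X, map_ofNat C]
  ring

lemma pderiv_one_nodalSextic :
    pderiv 1 nodalSextic =
      C 6 * (X 1 ^ 2 * (X 1 ^ 3 - X 0 ^ 3)) + C 4 * (X 1 ^ 3 * X 2 ^ 2) + X 2 ^ 5 := by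
  simp [nodalSextic, pderiv_X, map_ofNat C]
  ring

lemma pderiv_two_nodalSextic :
    pderiv 2 nodalSextic = C 2 * (X 1 ^ 4 * X 2) + C 5 * (X 1 * X 2 ^ 4) := by
  simp [nodalSextic, pderiv_X, map_ofNat C]
  ring

/-- Eisenstein's criterion in the variable `y` at the prime `x`. -/
lemma irreducible_nodalSextic : Irreducible nodalSextic := by
  let P : Ideal (MvPolynomial (Fin 2) ℂ) := Ideal.span {X 0}
  let c : MvPolynomial (Fin 2) ℂ := X 0 ^ 6 + X 0 ^ 4 * X 1 ^ 2 + X 0 * X 1 ^ 5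
  let q : Polynomial (MvPolynomial (Fin 2) ℂ) :=
    Polynomial.X ^ 6 + Polynomial.C (-2 * X 0 ^ 3) * Polynomial.X ^ 3 + Polynomial.C c
  have hprime : Prime (X 0 : MvPolynomial (Fin 2) ℂ) := X_prime
  have hP : P.IsPrime := (Ideal.span_singleton_prime hprime.ne_zero).2 hprime
  have hq : finSuccEquiv ℂ 2 nodalSextic = q := by
    have h1 : finSuccEquiv ℂ 2 (X 1) = Polynomial.C (X 0) := finSuccEquiv_X_succ (j := 0)
    have h2 : finSuccEquiv ℂ 2 (X 2) = Polynomial.C (X 1) := finSuccEquiv_X_succ (j := 1)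
    simp only [nodalSextic, q, c, map_add, map_sub, map_mul, map_pow, map_neg, map_ofNat,
      finSuccEquiv_X_zero, h1, h2]
    ring
  have hdeg : q.natDegree = 6 := by
    simp only [q]
    compute_degree!
  have hmonic : q.Monic := by
    simp only [q]
    monicity!
  refine (MulEquiv.irreducible_iff (finSuccEquiv ℂ 2)).1 ?_
  rw [hq]
  refine Polynomial.irreducible_of_eisenstein_criterion hP ?_ ?_ ?_ ?_ hmonic.isPrimitive
  · rw [hmonic.leadingCoeff]
    exact (Ideal.ne_top_iff_one P).1 hP.ne_top
  · intro n hn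
    have hn6 : n ≠ 6 := by
      rintro rfl
      rw [Polynomial.degree_eq_natDegree hmonic.ne_zero, hdeg] at hn
      exact lt_irrefl _ hn
    have hc : c ∈ P := Ideal.mem_span_singleton.2 ⟨X 0 ^ 5 + X 0 ^ 3 * X 1 ^ 2 + X 1 ^ 5, by ring⟩
    have hm : (-2 * X 0 ^ 3 : MvPolynomial (Fin 2) ℂ) ∈ P :=
      Ideal.mem_span_singleton.2 ⟨-2 * X 0 ^ 2, by ring⟩
    simp only [q, Polynomial.coeff_add, Polynomial.coeff_X_pow, if_neg hn6,
      Polynomial.coeff_C_mul, Polynomial.coeff_C]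
    refine P.add_mem (P.add_mem P.zero_mem (P.mul_mem_right _ hm)) ?_
    split_ifs
    exacts [hc, P.zero_mem]
  · rw [Polynomial.degree_eq_natDegree hmonic.ne_zero, hdeg]
    norm_num
  · intro hmem
    have h0 : q.coeff 0 = c := by simp [q]
    rw [h0, Ideal.span_singleton_pow, Ideal.mem_span_singleton] at hmem
    obtain ⟨r, hr⟩ := hmem
    have hr' : X 0 ^ 5 + X 0 ^ 3 * X 1 ^ 2 + X 1 ^ 5 = X 0 * r :=
      mul_left_cancel₀ hprime.ne_zero (by linear_combination hr)
    simpa using congrArg (eval ![0, 1]) hr'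

lemma nodalSextic_node {ζ : ℂ} (hζ : ζ ^ 3 = 1) :
    eval ![ζ, 1, 0] nodalSextic = 0 ∧ mvGradient nodalSextic ![ζ, 1, 0] = 0 := by
  refine ⟨by simp [eval_nodalSextic, hζ], ?_⟩
  ext i
  fin_cases i <;>
    simp [mvGradient, pderiv_zero_nodalSextic, pderiv_one_nodalSextic, pderiv_two_nodalSextic, hζ]

lemma mvHessian_nodalSextic {ζ : ℂ} (hζ : ζ ^ 3 = 1) :
    mvHessian nodalSextic ![ζ, 1, 0] =
      !![18 * ζ ^ 4, -18 * ζ ^ 2, 0; -18 * ζ ^ 2, 18, 0; 0, 0, 2] := by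
  ext i j
  fin_cases i <;> fin_cases j <;>
    simp [mvHessian, pderiv_zero_nodalSextic, pderiv_one_nodalSextic, pderiv_two_nodalSextic,
      pderiv_X, hζ] <;> ring

lemma rank_mvHessian_nodalSextic {ζ : ℂ} (hζ : ζ ^ 3 = 1) :
    (mvHessian nodalSextic ![ζ, 1, 0]).rank = 2 := by
  rw [mvHessian_nodalSextic hζ]
  set M : Matrix (Fin 3) (Fin 3) ℂ :=
    !![18 * ζ ^ 4, -18 * ζ ^ 2, 0; -18 * ζ ^ 2, 18, 0; 0, 0, 2] with hM
  apply le_antisymm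
  · have hfac : M = !![-ζ ^ 2, 0; 1, 0; 0, 1] * !![-18 * ζ ^ 2, 18, 0; 0, 0, 2] := by
      ext i j
      fin_cases i <;> fin_cases j <;> simp [hM, Matrix.mul_apply, Fin.sum_univ_two] <;> ring
    rw [hfac]
    exact (Matrix.rank_mul_le_left _ _).trans (Matrix.rank_le_width _)
  · have hone : (!![0, 1 / 18, 0; 0, 0, 1 / 2] : Matrix (Fin 2) (Fin 3) ℂ) * M *
        (!![0, 0; 1, 0; 0, 1] : Matrix (Fin 3) (Fin 2) ℂ) = 1 := by
      ext i j
      fin_cases i <;> fin_cases j <;> simp [hM, Matrix.mul_apply, Fin.sum_univ_three]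
    calc 2 = (1 : Matrix (Fin 2) (Fin 2) ℂ).rank := by simp [Matrix.rank_one]
      _ ≤ M.rank := by
        rw [← hone]
        exact (Matrix.rank_mul_le_left _ _).trans (Matrix.rank_mul_le_right _ _)

lemma nodalSextic_singular {v : Fin 3 → ℂ} (hf : eval v nodalSextic = 0)
    (hgrad : ∀ i, eval v (pderiv i nodalSextic) = 0) : v 2 = 0 ∧ v 0 ^ 3 = v 1 ^ 3 := by
  have h0 := hgrad 0
  have h1 := hgrad 1
  have h2 := hgrad 2
  rw [eval_nodalSextic] at hf
  simp only [pderiv_zero_nodalSextic, pderiv_one_nodalSextic, pderiv_two_nodalSextic, map_add,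
    map_sub, map_mul, map_pow, eval_X, eval_C] at h0 h1 h2
  generalize v 0 = y at *
  generalize v 1 = x at *
  generalize v 2 = z at *
  have hz : z = 0 := by
    by_contra hz
    have hx : x ≠ 0 := by
      rintro rfl
      exact hz (by simpa using h1)
    have hxz : 2 * x ^ 3 + 5 * z ^ 3 = 0 :=
      mul_left_cancel₀ (mul_ne_zero hx hz) (by linear_combination h2)
    have h0' : y ^ 2 * (x ^ 3 - y ^ 3) = 0 := by linear_combination (-1 / 6) * h0
    rcases mul_eq_zero.1 h0' with hy | hxy
    · have hy0 : y = 0 := by simpa using hy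
      subst hy0
      have hsq : 5 * x ^ 2 + 3 * z ^ 2 = 0 :=
        mul_left_cancel₀ (pow_ne_zero 3 hz)
          (by linear_combination (-1 / 3) * h1 + (x ^ 2 + 2 / 3 * z ^ 2) * hxz)
      have : z ^ 6 = 0 := by
        linear_combination (4 / 3233) * (25 * x ^ 4 - 15 * x ^ 2 * z ^ 2 + 9 * z ^ 4) * hsq -
          (125 / 3233) * (2 * x ^ 3 - 5 * z ^ 3) * hxz
      exact hz (by simpa using this)
    · have : z ^ 5 = 0 := by
        linear_combination (-1 / 9) * h1 + (2 / 3) * x ^ 2 * hxy + (2 / 9) * z ^ 2 * hxz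
      exact hz (by simpa using this)
  subst hz
  refine ⟨rfl, ?_⟩
  have : (x ^ 3 - y ^ 3) ^ 2 = 0 := by simpa using hf
  exact (sub_eq_zero.1 (pow_eq_zero_iff two_ne_zero |>.1 this)).symm

lemma linearIndependent_nodes {ζ ξ : ℂ} (h : ζ ≠ ξ) :
    LinearIndependent ℂ ![![ζ, 1, 0], ![ξ, 1, 0]] := by
  rw [LinearIndependent.pair_iff]
  intro s t hst
  have h0 : s * ζ + t * ξ = 0 := by simpa using congrFun hst 0
  have h1 : s + t = 0 := by simpa using congrFun hst 1
  have hs : s = 0 :=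
    mul_right_cancel₀ (sub_ne_zero.2 h) (by linear_combination h0 - ξ * h1)
  exact ⟨hs, by simpa [hs] using h1⟩

/-- There exists an irreducible plane sextic curve over `ℂ` whose singular
points are exactly three distinct collinear ordinary double points
(Theorem 4.1 of the paper). -/
theorem stmt8 :
    ∃ (f : MvPolynomial (Fin 3) ℂ) (a b c : Fin 3 → ℂ),
      f ∈ MvPolynomial.homogeneousSubmodule (Fin 3) ℂ 6 ∧
      Irreducible f ∧
      a ≠ 0 ∧ b ≠ 0 ∧ c ≠ 0 ∧
      -- pairwise linearly independent: they give three distinct points of ℂP²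
      LinearIndependent ℂ ![a, b] ∧ LinearIndependent ℂ ![a, c] ∧
        LinearIndependent ℂ ![b, c] ∧
      -- collinear: contained in a common 2-dimensional linear subspace of ℂ³
      (∃ W : Submodule ℂ (Fin 3 → ℂ), Module.finrank ℂ W = 2 ∧
        a ∈ W ∧ b ∈ W ∧ c ∈ W) ∧
      -- (i) each of a, b, c is a singular point of {f = 0}
      (∀ p ∈ ({a, b, c} : Set (Fin 3 → ℂ)),
        MvPolynomial.eval p f = 0 ∧ mvGradient f p = 0) ∧
      -- (ii) each of a, b, c is an ordinary double point
      (∀ p ∈ ({a, b, c} : Set (Fin 3 → ℂ)), (mvHessian f p).rank = 2) ∧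
      -- (iii) there are no other singular points
      (∀ v : Fin 3 → ℂ, v ≠ 0 → MvPolynomial.eval v f = 0 →
        (¬ ∃ t : ℂ, v = t • a) → (¬ ∃ t : ℂ, v = t • b) → (¬ ∃ t : ℂ, v = t • c) →
        ∃ i : Fin 3, MvPolynomial.eval v (pderiv i f) ≠ 0) := by
  obtain ⟨ω, hω⟩ : ∃ ω : ℂ, IsPrimitiveRoot ω 3 :=
    ⟨_, Complex.isPrimitiveRoot_exp 3 (by norm_num)⟩
  have hω3 : ω ^ 3 = 1 := hω.pow_eq_one
  have hω1 : ω ≠ 1 := hω.ne_one (by norm_num)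
  have hω0 : ω ≠ 0 := hω.ne_zero (by norm_num)
  have hsum : ω ^ 2 + ω + 1 = 0 :=
    mul_left_cancel₀ (sub_ne_zero.2 hω1) (by linear_combination hω3)
  have hsq1 : ω ^ 2 ≠ 1 := hω.pow_ne_one_of_pos_of_lt (by norm_num) (by norm_num)
  have hsq : ω ≠ ω ^ 2 := fun h =>
    hω1 (mul_left_cancel₀ hω0 (by linear_combination -h))
  have hω6 : (ω ^ 2) ^ 3 = 1 := by rw [← pow_mul, mul_comm, pow_mul, hω3, one_pow]
  have hne (ζ : ℂ) : (![ζ, 1, 0] : Fin 3 → ℂ) ≠ 0 := fun h => by simpa using congrFun h 1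
  refine ⟨nodalSextic, ![1, 1, 0], ![ω, 1, 0], ![ω ^ 2, 1, 0], nodalSextic_isHomogeneous,
    irreducible_nodalSextic, hne _, hne _, hne _, linearIndependent_nodes hω1.symm,
    linearIndependent_nodes hsq1.symm, linearIndependent_nodes hsq, ?_, ?_, ?_, ?_⟩
  · refine ⟨Submodule.span ℂ (Set.range ![![1, 1, 0], ![ω, 1, 0]]),
      by simpa using finrank_span_eq_card (linearIndependent_nodes hω1.symm),
      Submodule.subset_span ⟨0, rfl⟩, Submodule.subset_span ⟨1, rfl⟩, ?_⟩
    rw [Matrix.range_cons_cons_empty, Submodule.mem_span_pair]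
    refine ⟨-ω, 1 + ω, ?_⟩
    ext i
    fin_cases i
    · simp
      ring
    · simp
    · simp
  · rintro p (rfl | rfl | rfl)
    exacts [nodalSextic_node (one_pow 3), nodalSextic_node hω3, nodalSextic_node hω6]
  · rintro p (rfl | rfl | rfl)
    exacts [rank_mvHessian_nodalSextic (one_pow 3), rank_mvHessian_nodalSextic hω3,
      rank_mvHessian_nodalSextic hω6]
  · intro v _ hf ha hb hc
    by_contra! hgrad
    obtain ⟨hz, hxy⟩ := nodalSextic_singular hf hgrad
    have hmul {ζ : ℂ} (h : v 0 - ζ * v 1 = 0) : ∃ t : ℂ, v = t • ![ζ, 1, 0] := by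
      refine ⟨v 1, ?_⟩
      ext i
      fin_cases i
      · simpa [mul_comm] using sub_eq_zero.1 h
      · simp
      · simpa using hz
    have hprod : (v 0 - 1 * v 1) * ((v 0 - ω * v 1) * (v 0 - ω ^ 2 * v 1)) = 0 := by
      linear_combination hxy + (ω * v 1 ^ 2 * v 0 - v 1 * v 0 ^ 2) * hsum - v 1 ^ 3 * hω3
    rcases mul_eq_zero.1 hprod with h | h
    · exact ha (hmul h)
    · rcases mul_eq_zero.1 h with h | h
      exacts [hb (hmul h), hc (hmul h)]
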